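/- arXiv:1711.03076 — 3 statements merged into one kernel-verified Lean document; each statement's English description precedes it below -/
import Mathlib

section
/- Let G = (V,E) be a graph on n ≥ 2 vertices, let ε ∈ (0,1), let k be an integer with 2 ≤ k ≤ n, and suppose MM(G) ≥ 4·ε^{-2}·k·log n. Let G^(1),…,G^(k) be a random k-partition of G, and for each i ∈ [k] let M_i be a maximum matching of G^(i), where M_i may be chosen by an arbitrary (deterministic) function of the graph G^(i). Then with probability at least 1 − 3/n, the graph H = (V, M_1 ∪ … ∪ M_k) satisfies MM(H) ≥ (1/3 − 3ε)·MM(G). -/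
/-- `M` is a matching of the graph `G`: a set of pairwise vertex-disjoint edges of `G`. -/
def IsMatching {V : Type*} (G : SimpleGraph V) (M : Set (Sym2 V)) : Prop :=
  M ⊆ G.edgeSet ∧ M.Pairwise fun e f => ∀ v : V, v ∈ e → v ∉ f

/-- `MM G` is the maximum cardinality of a matching in `G`. -/
noncomputable def MM {V : Type*} (G : SimpleGraph V) : ℕ :=
  sSup {n : ℕ | ∃ M : Set (Sym2 V), IsMatching G M ∧ n = M.ncard}

/-- The `i`-th part `G^(i)` of the random `k`-partition of `G` determined by the
assignment `ω` of potential edges to parts: it keeps the edges `e` of `G` with `ω e = i`. -/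
def part {V : Type*} (G : SimpleGraph V) {k : ℕ} (ω : Sym2 V → Fin k) (i : Fin k) :
    SimpleGraph V :=
  G ⊓ SimpleGraph.fromEdgeSet {e | ω e = i}

/-- Probability of the event `A` when each potential edge is assigned independently and
uniformly at random to one of the `k` parts. -/
noncomputable def PrU {V : Type*} [Fintype V] [DecidableEq V] {k : ℕ}
    (A : Set (Sym2 V → Fin k)) : ℝ :=
  (A.ncard : ℝ) / (Fintype.card (Sym2 V → Fin k) : ℝ)

open Finset in
/-- Lower-tail Chernoff bound for the number of indices `e` with `e ∈ T (f e)`, where `f` is a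
uniformly random map, given that `e ∈ T i` holds for at least a third of all pairs `(e, i)`. -/
theorem card_filter_hits_lt_le {ι : Type*} [Fintype ι] [DecidableEq ι] {k : ℕ} (hk : 0 < k)
    {ε : ℝ} (hε0 : 0 < ε) (T : Fin k → Finset ι)
    (hT : (Fintype.card ι : ℝ) * k ≤ 3 * ∑ i, (#(T i) : ℝ)) :
    (#{f : ι → Fin k | (#{e | e ∈ T (f e)} : ℝ) < (1 / 3 - 3 * ε) * Fintype.card ι} : ℝ) ≤
      Real.exp (-(2 * ε ^ 2 * Fintype.card ι)) * (k : ℝ) ^ Fintype.card ι := by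
  set μ : ℝ := (Fintype.card ι : ℝ)
  have hμ0 : 0 ≤ μ := by positivity
  have hk0 : (0 : ℝ) < k := by exact_mod_cast hk
  set g : ι → Fin k → ℝ := fun e i => if e ∈ T i then Real.exp (-ε) else 1 with hg
  have hg0 : ∀ e i, 0 < g e i := by
    intro e i
    simp only [hg]
    split_ifs <;> positivity
  have hprod : ∀ f : ι → Fin k, ∏ e, g e (f e) = Real.exp (-ε * #{e | e ∈ T (f e)}) := by
    intro f
    simp only [hg]
    rw [prod_ite, prod_const, prod_const_one, mul_one, ← Real.exp_nat_mul, mul_comm]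
  have hexp : Real.exp (-ε) ≤ 1 - (ε - ε ^ 2) := by
    have h1 : 1 + ε ≤ Real.exp ε := by linarith [Real.add_one_le_exp ε]
    rw [Real.exp_neg]
    refine (inv_anti₀ (by positivity) h1).trans ?_
    rw [inv_le_iff_one_le_mul₀ (by positivity)]
    nlinarith [pow_pos hε0 3]
  have hrow : ∀ e, ∑ i, g e i ≤
      k * Real.exp (-(1 - Real.exp (-ε)) * (#{i | e ∈ T i} : ℝ) / k) := by
    intro e
    have h1 : ∑ i, g e i = k + -(1 - Real.exp (-ε)) * (#{i | e ∈ T i} : ℝ) := by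
      have : ∀ i, g e i = 1 + if e ∈ T i then -(1 - Real.exp (-ε)) else 0 := by
        intro i
        simp only [hg]
        split_ifs <;> ring
      simp_rw [this]
      rw [sum_add_distrib, ← sum_filter, sum_const, sum_const]
      simp
      ring
    rw [h1]
    refine le_trans (le_of_eq ?_) (mul_le_mul_of_nonneg_left (Real.add_one_le_exp _) hk0.le)
    field_simp
    ring
  have hswap : ∑ e, (#{i | e ∈ T i} : ℝ) = ∑ i, (#(T i) : ℝ) := by
    have := sum_card_bipartiteAbove_eq_sum_card_bipartiteBelow (s := (univ : Finset ι))
      (t := (univ : Finset (Fin k))) (fun e i => e ∈ T i)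
    simp only [bipartiteAbove, bipartiteBelow, filter_mem_eq_inter, univ_inter] at this
    exact_mod_cast this
  have htotal : ∑ f : ι → Fin k, ∏ e, g e (f e) ≤
      (k : ℝ) ^ Fintype.card ι * Real.exp (-(ε - ε ^ 2) * (μ / 3)) := by
    calc ∑ f : ι → Fin k, ∏ e, g e (f e) = ∏ e, ∑ i, g e i := by
          rw [prod_univ_sum, Fintype.piFinset_univ]
      _ ≤ ∏ e, (k * Real.exp (-(1 - Real.exp (-ε)) * (#{i | e ∈ T i} : ℝ) / k)) :=
          prod_le_prod (fun e _ => sum_nonneg fun i _ => (hg0 e i).le) fun e _ => hrow e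
      _ = (k : ℝ) ^ Fintype.card ι *
            Real.exp (-(1 - Real.exp (-ε)) * ((∑ i, (#(T i) : ℝ)) / k)) := by
          rw [prod_mul_distrib, prod_const, ← Real.exp_sum, ← sum_div, ← mul_sum, hswap,
            card_univ, mul_div_assoc]
      _ ≤ _ := by
          gcongr ?_ * Real.exp ?_
          have h3 : μ / 3 ≤ (∑ i, (#(T i) : ℝ)) / k := by
            rw [le_div_iff₀ hk0]
            linarith
          have h4 : 0 ≤ 1 - Real.exp (-ε) := by
            have : Real.exp (-ε) ≤ 1 := Real.exp_le_one_iff.mpr (by linarith)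
            linarith
          nlinarith [mul_le_mul_of_nonneg_left h3 h4,
            mul_le_mul_of_nonneg_right hexp (div_nonneg hμ0 (by norm_num : (0 : ℝ) ≤ 3))]
  have hmarkov :
      (#{f : ι → Fin k | (#{e | e ∈ T (f e)} : ℝ) < (1 / 3 - 3 * ε) * μ} : ℝ) ≤
        ∑ f : ι → Fin k, Real.exp (ε * ((1 / 3 - 3 * ε) * μ)) * ∏ e, g e (f e) := by
    rw [card_eq_sum_ones, Nat.cast_sum, sum_filter]
    refine sum_le_sum fun f _ => ?_
    rw [hprod, ← Real.exp_add]
    split_ifs with h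
    · rw [Nat.cast_one]
      refine Real.one_le_exp ?_
      nlinarith
    · positivity
  rw [← mul_sum] at hmarkov
  refine hmarkov.trans ((mul_le_mul_of_nonneg_left htotal (Real.exp_pos _).le).trans ?_)
  rw [mul_left_comm, ← Real.exp_add, mul_comm]
  gcongr
  nlinarith [mul_nonneg (sq_nonneg ε) hμ0]

/-- A set of maps each of whose fibres over the restriction to `sᶜ` has density at most `p` has
density at most `p`. -/
theorem ncard_le_of_fiberwise {α : Type*} [Fintype α] [DecidableEq α] {k : ℕ}
    (s : Finset α) (B : Set (α → Fin k)) (p : ℝ)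
    (h : ∀ ω : {a // a ∉ s} → Fin k,
      ({f : {a // a ∈ s} → Fin k |
        (Equiv.piEquivPiSubtypeProd (· ∈ s) fun _ => Fin k).symm (f, ω) ∈ B}.ncard : ℝ) ≤
          p * Fintype.card ({a // a ∈ s} → Fin k)) :
    (B.ncard : ℝ) ≤ p * Fintype.card (α → Fin k) := by
  classical
  set e := Equiv.piEquivPiSubtypeProd (· ∈ s) fun _ => Fin k
  have hB : B.ncard = ∑ ω : {a // a ∉ s} → Fin k,
      {f : {a // a ∈ s} → Fin k | e.symm (f, ω) ∈ B}.ncard := by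
    simp_rw [Set.ncard_eq_toFinset_card', Set.toFinset_ofPred, Finset.card_filter]
    rw [← Fintype.sum_prod_type_right (f := fun x => if e.symm x ∈ B then 1 else 0),
      Equiv.sum_comp e.symm (fun x => if x ∈ B then 1 else 0), ← Finset.card_filter]
    congr 1
    ext
    simp
  rw [hB, Nat.cast_sum]
  refine (Finset.sum_le_sum fun ω _ => h ω).trans (le_of_eq ?_)
  rw [Fintype.card_congr e, Fintype.card_prod, Finset.sum_const, Finset.card_univ, nsmul_eq_mul]
  push_cast
  ring

section Matching

variable {V : Type*}

theorem mem_edgeSet_part {G : SimpleGraph V} {k : ℕ} {ω : Sym2 V → Fin k} {i : Fin k}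
    {e : Sym2 V} : e ∈ (part G ω i).edgeSet ↔ e ∈ G.edgeSet ∧ ω e = i := by
  rw [part, SimpleGraph.edgeSet_inf, SimpleGraph.edgeSet_fromEdgeSet]
  constructor
  · rintro ⟨h1, h2, -⟩
    exact ⟨h1, h2⟩
  · rintro ⟨h1, h2⟩
    exact ⟨h1, h2, G.not_isDiag_of_mem_edgeSet h1⟩

theorem part_deleteEdges_congr {G : SimpleGraph V} {M : Set (Sym2 V)} {k : ℕ}
    {ω ω' : Sym2 V → Fin k} (h : ∀ e ∉ M, ω e = ω' e) (i : Fin k) :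
    part (G.deleteEdges M) ω i = part (G.deleteEdges M) ω' i := by
  rw [← SimpleGraph.edgeSet_inj]
  ext e
  simp only [mem_edgeSet_part, SimpleGraph.edgeSet_deleteEdges, Set.mem_sdiff]
  refine and_congr_right fun he => ?_
  rw [h e he.2]

/-- The edges of `M` that share no vertex with an edge of `N`. -/
def avoiding (M N : Set (Sym2 V)) : Set (Sym2 V) :=
  {e ∈ M | ∀ f ∈ N, ∀ v ∈ e, v ∉ f}

variable [Fintype V]

theorem IsMatching.ncard_le_MM {G : SimpleGraph V} {M : Set (Sym2 V)} (hM : IsMatching G M) :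
    M.ncard ≤ MM G := by
  classical
  refine le_csSup ⟨Fintype.card (Sym2 V), ?_⟩ ⟨M, hM, rfl⟩
  rintro _ ⟨M', -, rfl⟩
  rw [← Nat.card_eq_fintype_card]
  exact Set.ncard_le_card M'

theorem exists_isMatching_ncard_eq_MM (G : SimpleGraph V) :
    ∃ M, IsMatching G M ∧ M.ncard = MM G := by
  classical
  have hmem : MM G ∈ {n : ℕ | ∃ M : Set (Sym2 V), IsMatching G M ∧ n = M.ncard} := by
    refine Nat.sSup_mem ⟨0, ∅, ⟨Set.empty_subset _, Set.pairwise_empty _⟩, by simp⟩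
      ⟨Fintype.card (Sym2 V), ?_⟩
    rintro _ ⟨M', -, rfl⟩
    rw [← Nat.card_eq_fintype_card]
    exact Set.ncard_le_card M'
  obtain ⟨M, hM, h⟩ := hmem
  exact ⟨M, hM, h.symm⟩

theorem IsMatching.ncard_le_ncard_avoiding_add {G : SimpleGraph V} {M : Set (Sym2 V)}
    (hM : IsMatching G M) (N : Set (Sym2 V)) :
    M.ncard ≤ (avoiding M N).ncard + 2 * N.ncard := by
  classical
  have hcover : {v | ∃ f ∈ N, v ∈ f}.ncard ≤ 2 * N.ncard := by
    have h : {v | ∃ f ∈ N, v ∈ f} = (N.toFinset.biUnion Sym2.toFinset : Finset V) := by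
      ext v
      simp
    rw [h, Set.ncard_coe_finset, Set.ncard_eq_toFinset_card', mul_comm]
    refine Finset.card_biUnion_le_card_mul _ _ _ fun f _ => ?_
    rw [Sym2.card_toFinset]
    split_ifs <;> norm_num
  have hhit : ∀ e ∈ M \ avoiding M N, ∃ v ∈ e, ∃ f ∈ N, v ∈ f := by
    rintro e ⟨he, hne⟩
    by_contra! hcon
    exact hne ⟨he, fun f hf v hv => hcon v hv f hf⟩
  choose v hv hvN using fun e : ↥(M \ avoiding M N) => hhit e e.2
  have hinj : (M \ avoiding M N).ncard ≤ {v | ∃ f ∈ N, v ∈ f}.ncard := by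
    rw [← Nat.card_coe_set_eq, ← Nat.card_coe_set_eq]
    refine Nat.card_le_card_of_injective (fun e => ⟨v e, hvN e⟩) fun e e' hee' => ?_
    by_contra hne
    have hv' : v e = v e' := congrArg Subtype.val hee'
    exact hM.2 e.2.1 e'.2.1 (fun h => hne (Subtype.ext h)) (v e) (hv e) (hv' ▸ hv e')
  have := Set.ncard_sdiff_add_ncard_of_subset (show avoiding M N ⊆ M from fun _ h => h.1)
  omega

/-- A maximum matching of a part picks up at least as many edges of the matching `M` as there are
edges of `M` in that part avoiding a maximum matching of the part without `M`. -/
theorem ncard_avoiding_le_ncard_inter {G : SimpleGraph V} {M : Set (Sym2 V)}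
    (hM : IsMatching G M) {k : ℕ} {ω : Sym2 V → Fin k} {i : Fin k} {A N : Set (Sym2 V)}
    (hA : IsMatching (part G ω i) A) (hAmax : A.ncard = MM (part G ω i))
    (hN : IsMatching (part (G.deleteEdges M) ω i) N)
    (hNmax : N.ncard = MM (part (G.deleteEdges M) ω i)) :
    {e ∈ avoiding M N | ω e = i}.ncard ≤ (A ∩ M).ncard := by
  have hNmem : ∀ e ∈ N, (e ∈ G.edgeSet ∧ e ∉ M) ∧ ω e = i := by
    intro e he
    have := mem_edgeSet_part.1 (hN.1 he)
    rwa [SimpleGraph.edgeSet_deleteEdges] at this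
  have hunion : IsMatching (part G ω i) (N ∪ {e ∈ avoiding M N | ω e = i}) := by
    refine ⟨?_, ?_⟩
    · rintro e (he | he)
      · exact mem_edgeSet_part.2 ⟨(hNmem e he).1.1, (hNmem e he).2⟩
      · exact mem_edgeSet_part.2 ⟨hM.1 he.1.1, he.2⟩
    · rintro e (he | he) f (hf | hf) hne v hve hvf
      · exact hN.2 he hf hne v hve hvf
      · exact hf.1.2 e he v hvf hve
      · exact he.1.2 f hf v hve hvf
      · exact hM.2 he.1.1 hf.1.1 hne v hve hvf
  have hdisj : Disjoint N {e ∈ avoiding M N | ω e = i} :=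
    Set.disjoint_left.2 fun e he he' => (hNmem e he).1.2 he'.1.1
  have hdiff : IsMatching (part (G.deleteEdges M) ω i) (A \ M) := by
    refine ⟨fun e he => mem_edgeSet_part.2 ?_, hA.2.mono Set.sdiff_subset⟩
    have := mem_edgeSet_part.1 (hA.1 he.1)
    rw [SimpleGraph.edgeSet_deleteEdges]
    exact ⟨⟨this.1, he.2⟩, this.2⟩
  have h1 := hunion.ncard_le_MM
  rw [Set.ncard_union_eq hdisj] at h1
  have h2 := hdiff.ncard_le_MM
  have h3 := Set.ncard_inter_add_ncard_sdiff_eq_ncard A M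
  omega

/-- The union of maximum matchings of the parts contains a matching that is at least as large as a
maximum matching of any part without `M`. -/
theorem MM_part_deleteEdges_le {G : SimpleGraph V} (M : Set (Sym2 V)) {k : ℕ}
    {ω : Sym2 V → Fin k} {A : Fin k → Set (Sym2 V)}
    (hA : ∀ i, IsMatching (part G ω i) (A i) ∧ (A i).ncard = MM (part G ω i)) (i : Fin k) :
    MM (part (G.deleteEdges M) ω i) ≤ MM (SimpleGraph.fromEdgeSet (⋃ i, A i)) := by
  obtain ⟨N, hN, hNmax⟩ := exists_isMatching_ncard_eq_MM (part (G.deleteEdges M) ω i)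
  have hN' : IsMatching (part G ω i) N := by
    refine ⟨fun e he => ?_, hN.2⟩
    have := mem_edgeSet_part.1 (hN.1 he)
    rw [SimpleGraph.edgeSet_deleteEdges] at this
    exact mem_edgeSet_part.2 ⟨this.1.1, this.2⟩
  have hAi : IsMatching (SimpleGraph.fromEdgeSet (⋃ i, A i)) (A i) := by
    refine ⟨fun e he => ?_, (hA i).1.2⟩
    rw [SimpleGraph.edgeSet_fromEdgeSet]
    exact ⟨Set.mem_iUnion_of_mem i he,
      (part G ω i).not_isDiag_of_mem_edgeSet ((hA i).1.1 he)⟩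
  rw [← hNmax]
  exact hN'.ncard_le_MM.trans ((hA i).2 ▸ hAi.ncard_le_MM)

/-- The union of maximum matchings of the parts contains at least as many edges of the matching
`M` as there are edges of `M` avoiding a maximum matching of their part without `M`. -/
theorem ncard_avoiding_le_MM_fromEdgeSet {G : SimpleGraph V} {M : Set (Sym2 V)}
    (hM : IsMatching G M) {k : ℕ} {ω : Sym2 V → Fin k} {A N : Fin k → Set (Sym2 V)}
    (hA : ∀ i, IsMatching (part G ω i) (A i) ∧ (A i).ncard = MM (part G ω i))
    (hN : ∀ i, IsMatching (part (G.deleteEdges M) ω i) (N i) ∧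
      (N i).ncard = MM (part (G.deleteEdges M) ω i)) :
    {e | e ∈ avoiding M (N (ω e))}.ncard ≤ MM (SimpleGraph.fromEdgeSet (⋃ i, A i)) := by
  classical
  have hmatch : IsMatching (SimpleGraph.fromEdgeSet (⋃ i, A i)) ((⋃ i, A i) ∩ M) := by
    refine ⟨fun e he => ?_, hM.2.mono Set.inter_subset_right⟩
    rw [SimpleGraph.edgeSet_fromEdgeSet]
    exact ⟨he.1, G.not_isDiag_of_mem_edgeSet (hM.1 he.2)⟩
  refine le_trans ?_ hmatch.ncard_le_MM
  have hcolor : ∀ i, ∀ e ∈ A i, ω e = i := fun i e he =>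
    (mem_edgeSet_part.1 ((hA i).1.1 he)).2
  simp_rw [Set.ncard_eq_toFinset_card']
  rw [Finset.card_eq_sum_card_fiberwise (f := ω) (t := Finset.univ) (by simp),
    Finset.card_eq_sum_card_fiberwise (f := ω) (t := Finset.univ) (by simp)]
  refine Finset.sum_le_sum fun i _ => ?_
  have h := ncard_avoiding_le_ncard_inter hM (hA i).1 (hA i).2 (hN i).1 (hN i).2
  simp_rw [Set.ncard_eq_toFinset_card'] at h
  refine le_trans (Finset.card_le_card fun e he => ?_)
    (h.trans (Finset.card_le_card fun e he => ?_))
  · simp only [Finset.mem_filter, Set.mem_toFinset, Set.mem_ofPred_eq] at he ⊢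
    exact ⟨he.2 ▸ he.1, he.2⟩
  · simp only [Finset.mem_filter, Set.mem_toFinset, Set.mem_inter_iff, Set.mem_iUnion] at he ⊢
    exact ⟨⟨⟨i, he.1⟩, he.2⟩, hcolor i e he.1⟩

end Matching

/-- Let `G` be a graph on `n ≥ 2` vertices with `MM(G) ≥ 4·ε⁻²·k·log n`, where `ε ∈ (0,1)`
and `2 ≤ k ≤ n`.  Take a random `k`-partition `G^(1),…,G^(k)` of `G` and, for each `i`, a
maximum matching `Mᵢ := F i G^(i)` of `G^(i)` chosen by an arbitrary deterministic function
of the graph `G^(i)`.  Then with probability at least `1 - 3/n`, the graph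
`H = (V, M₁ ∪ … ∪ M_k)` satisfies `MM(H) ≥ (1/3 - 3ε)·MM(G)`. -/
theorem maxmatching_coreset_three_approx {V : Type*} [Fintype V] [DecidableEq V]
    (G : SimpleGraph V) (ε : ℝ) (hε0 : 0 < ε) (hε1 : ε < 1) (k : ℕ)
    (hn : 2 ≤ Fintype.card V) (hk : 2 ≤ k) (hkn : k ≤ Fintype.card V)
    (hμ : 4 * ε⁻¹ ^ 2 * (k : ℝ) * Real.log (Fintype.card V) ≤ (MM G : ℝ))
    (F : Fin k → SimpleGraph V → Set (Sym2 V))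
    (hF : ∀ (ω : Sym2 V → Fin k) (i : Fin k),
      IsMatching (part G ω i) (F i (part G ω i)) ∧
        (F i (part G ω i)).ncard = MM (part G ω i)) :
    1 - 3 / (Fintype.card V : ℝ) ≤
      PrU {ω : Sym2 V → Fin k |
        (1 / 3 - 3 * ε) * (MM G : ℝ) ≤
          (MM (SimpleGraph.fromEdgeSet (⋃ i : Fin k, F i (part G ω i))) : ℝ)} := by
  classical
  obtain ⟨M, hM, hMmax⟩ := exists_isMatching_ncard_eq_MM G
  rw [← hMmax] at hμ ⊢
  choose N hN using fun H : SimpleGraph V => exists_isMatching_ncard_eq_MM H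
  have hn2 : (2 : ℝ) ≤ Fintype.card V := by exact_mod_cast hn
  set n : ℝ := (Fintype.card V : ℝ)
  have hk0 : 0 < k := by omega
  have : Nonempty (Fin k) := ⟨⟨0, hk0⟩⟩
  set good : Set (Sym2 V → Fin k) := {ω | (1 / 3 - 3 * ε) * (M.ncard : ℝ) ≤
    (MM (SimpleGraph.fromEdgeSet (⋃ i : Fin k, F i (part G ω i))) : ℝ)} with hgood
  have hcardM : Fintype.card {e // e ∈ M.toFinset} = M.ncard := by
    rw [Fintype.card_coe, Set.ncard_eq_toFinset_card']
  have hbad : (goodᶜ.ncard : ℝ) ≤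
      Real.exp (-(2 * ε ^ 2 * M.ncard)) * Fintype.card (Sym2 V → Fin k) := by
    refine ncard_le_of_fiberwise M.toFinset _ _ fun ω' => ?_
    set extend : ({e // e ∈ M.toFinset} → Fin k) → Sym2 V → Fin k := fun f =>
      (Equiv.piEquivPiSubtypeProd (· ∈ M.toFinset) fun _ => Fin k).symm (f, ω')
    have hext : ∀ f (e : {e // e ∈ M.toFinset}), extend f e = f e := by
      intro f e
      have he : (e : Sym2 V) ∈ M := Set.mem_toFinset.1 e.2
      simp [extend, Equiv.piEquivPiSubtypeProd, he]
    set A : Fin k → Set (Sym2 V) := fun i =>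
      N (part (G.deleteEdges M) (extend fun _ => Classical.arbitrary _) i)
    have hA : ∀ f i, IsMatching (part (G.deleteEdges M) (extend f) i) (A i) ∧
        (A i).ncard = MM (part (G.deleteEdges M) (extend f) i) := by
      intro f i
      rw [part_deleteEdges_congr (ω' := extend fun _ => Classical.arbitrary _) _ i]
      · exact hN _
      · intro e he
        simp [extend, Equiv.piEquivPiSubtypeProd, he]
    by_cases hsmall : ∀ i, 3 * (A i).ncard ≤ M.ncard
    · set T : Fin k → Finset {e // e ∈ M.toFinset} := fun i =>
        {e | (e : Sym2 V) ∈ avoiding M (A i)}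
      have hTcard : ∀ i, (T i).card = (avoiding M (A i)).ncard := by
        intro i
        rw [Set.ncard_eq_toFinset_card', ← Finset.card_map (Function.Embedding.subtype _)]
        congr 1
        ext e
        simp only [T, Finset.mem_map, Finset.mem_filter, Finset.mem_univ, true_and,
          Function.Embedding.subtype_apply, Set.mem_toFinset]
        exact ⟨fun ⟨a, ha, hae⟩ => hae ▸ ha, fun he => ⟨⟨e, by simpa using he.1⟩, he, rfl⟩⟩
      have hT : (Fintype.card {e // e ∈ M.toFinset} : ℝ) * k ≤ 3 * ∑ i, ((T i).card : ℝ) := by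
        have h : ∀ i ∈ Finset.univ, M.ncard ≤ 3 * (T i).card := by
          intro i _
          have := hM.ncard_le_ncard_avoiding_add (A i)
          have := hsmall i
          rw [hTcard]
          omega
        have := Finset.card_nsmul_le_sum Finset.univ _ _ h
        rw [← Finset.mul_sum, Finset.card_univ, Fintype.card_fin, smul_eq_mul, mul_comm] at this
        rw [hcardM]
        exact_mod_cast this
      have hchernoff := card_filter_hits_lt_le hk0 hε0 T hT
      rw [Fintype.card_fun, Fintype.card_fin, Nat.cast_pow]
      rw [← hcardM]
      refine le_trans ?_ hchernoff
      rw [← Set.ncard_coe_finset, Nat.cast_le]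
      refine Set.ncard_le_ncard fun f hf => ?_
      have hf' : (MM (SimpleGraph.fromEdgeSet (⋃ i, F i (part G (extend f) i))) : ℝ) <
          (1 / 3 - 3 * ε) * Fintype.card {e // e ∈ M.toFinset} := by
        rw [hcardM]
        exact not_le.1 hf
      simp only [Finset.coe_filter, Finset.mem_univ, true_and, Set.mem_ofPred_eq]
      refine lt_of_le_of_lt ?_ hf'
      rw [Nat.cast_le]
      refine le_trans ?_ (ncard_avoiding_le_MM_fromEdgeSet hM (hF (extend f)) (hA f))
      rw [Set.ncard_eq_toFinset_card', ← Finset.card_map (Function.Embedding.subtype _)]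
      refine Finset.card_le_card fun e he => ?_
      simp only [T, Finset.mem_map, Finset.mem_filter, Finset.mem_univ, true_and,
        Function.Embedding.subtype_apply] at he
      obtain ⟨a, ha, rfl⟩ := he
      simpa [hext] using ha
    · push Not at hsmall
      obtain ⟨i, hi⟩ := hsmall
      have hempty : {f | extend f ∈ goodᶜ} = ∅ := by
        refine Set.eq_empty_of_forall_notMem fun f hf => hf ?_
        have h := MM_part_deleteEdges_le M (hF (extend f)) i
        rw [← (hA f i).2] at h
        have h1 : (M.ncard : ℝ) ≤
            3 * (MM (SimpleGraph.fromEdgeSet (⋃ i, F i (part G (extend f) i))) : ℝ) := by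
          exact_mod_cast hi.le.trans (Nat.mul_le_mul_left 3 h)
        have h2 : 0 ≤ ε * (M.ncard : ℝ) := by positivity
        simp only [hgood, Set.mem_ofPred_eq]
        linarith
      change (({f | extend f ∈ goodᶜ}.ncard : ℕ) : ℝ) ≤ _
      rw [hempty, Set.ncard_empty, Nat.cast_zero]
      positivity
  have hexp : Real.exp (-(2 * ε ^ 2 * M.ncard)) ≤ 3 / n := by
    have hlog : 0 ≤ Real.log n := Real.log_nonneg (by linarith)
    have hk1 : (1 : ℝ) ≤ k := by exact_mod_cast hk0
    have h1 : 4 * (k : ℝ) * Real.log n ≤ ε ^ 2 * M.ncard := by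
      have := mul_le_mul_of_nonneg_left hμ (sq_nonneg ε)
      calc 4 * (k : ℝ) * Real.log n = ε ^ 2 * (4 * ε⁻¹ ^ 2 * k * Real.log n) := by field_simp
        _ ≤ _ := this
    have h2 : Real.log n ≤ 2 * ε ^ 2 * M.ncard := by nlinarith
    calc Real.exp (-(2 * ε ^ 2 * M.ncard)) ≤ Real.exp (-Real.log n) :=
          Real.exp_le_exp.2 (neg_le_neg h2)
      _ = 1 / n := by rw [Real.exp_neg, Real.exp_log (by linarith), one_div]
      _ ≤ 3 / n := by gcongr; norm_num
  have hΩ : (0 : ℝ) < Fintype.card (Sym2 V → Fin k) := by exact_mod_cast Fintype.card_pos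
  have hcompl : (good.ncard : ℝ) + goodᶜ.ncard = Fintype.card (Sym2 V → Fin k) := by
    rw [← Nat.card_eq_fintype_card]
    exact_mod_cast Set.ncard_add_ncard_compl good
  rw [PrU, le_div_iff₀ hΩ]
  have := mul_le_mul_of_nonneg_right hexp hΩ.le
  linarith
end

section
/- Let G = (V,E) be a graph on n ≥ 2 vertices, p ∈ (0,1], λ ∈ (0,1/2), and β a real with β ≥ 750·λ^{-2}·log n. Let H be an EDCS(G, β_H, β_H − 1) with β_H := (1 − λ/2)·β/p. Let G_p := G^E_p be the edge sampled subgraph of G with probability p, and let H_p := H ∩ G_p (the edges of H that are sampled into G_p). Then with probability at least 1 − 2/n⁹: (1) for every vertex v ∈ V, |deg_{H_p}(v) − p·deg_H(v)| ≤ (λ/5)·β; and (2) H_p is an EDCS(G_p, β, (1−λ)·β). -/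
/-- The degree of vertex `v` in the (sub)graph `H`. -/
noncomputable def deg {V : Type*} (H : SimpleGraph V) (v : V) : ℕ :=
  (H.neighborSet v).ncard

/-- `H` is an edge degree constrained subgraph `EDCS(G, β, β⁻)`. -/
def IsEDCS {V : Type*} (G H : SimpleGraph V) (β βm : ℝ) : Prop :=
  H ≤ G ∧
    (∀ u v : V, H.Adj u v → (deg H u : ℝ) + (deg H v : ℝ) ≤ β) ∧
    (∀ u v : V, G.Adj u v → ¬ H.Adj u v → βm ≤ (deg H u : ℝ) + (deg H v : ℝ))

/-- The probability weight of the outcome `ω` when each potential edge is kept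
independently with probability `p`. -/
noncomputable def pw {V : Type*} [Fintype V] [DecidableEq V] (p : ℝ)
    (ω : Sym2 V → Bool) : ℝ :=
  ∏ e : Sym2 V, (if ω e then p else 1 - p)

/-- The edge sampled subgraph of `G` determined by the outcome `ω`: it keeps exactly the
edges `e` of `G` with `ω e = true`. -/
def esub {V : Type*} (G : SimpleGraph V) (ω : Sym2 V → Bool) : SimpleGraph V :=
  G ⊓ SimpleGraph.fromEdgeSet {e | ω e = true}

/-- Probability of the event `A` under the edge-sampling distribution with probability `p`. -/
noncomputable def PrE {V : Type*} [Fintype V] [DecidableEq V] (p : ℝ)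
    (A : Set (Sym2 V → Bool)) : ℝ :=
  ∑ ω : Sym2 V → Bool, A.indicator (pw p) ω

/-- The expectation of a product of functions of the individual edge indicators factorizes. -/
theorem sum_pw_mul_prod {V : Type*} [Fintype V] [DecidableEq V] (p : ℝ)
    (f : Sym2 V → Bool → ℝ) :
    ∑ ω : Sym2 V → Bool, pw p ω * ∏ e, f e (ω e) =
      ∏ e, (p * f e true + (1 - p) * f e false) := by
  have h := Finset.prod_univ_sum (fun _ : Sym2 V => (Finset.univ : Finset Bool))
    (fun e b => (if b then p else 1 - p) * f e b)
  simp only [Fintype.piFinset_univ, Fintype.sum_bool] at h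
  simp only [pw, ← Finset.prod_mul_distrib]
  simpa using h.symm

theorem sum_pw {V : Type*} [Fintype V] [DecidableEq V] (p : ℝ) :
    ∑ ω : Sym2 V → Bool, pw p ω = 1 := by
  simpa using sum_pw_mul_prod (V := V) p (fun _ _ => 1)

theorem pw_nonneg {V : Type*} [Fintype V] [DecidableEq V] {p : ℝ} (hp0 : 0 ≤ p) (hp1 : p ≤ 1)
    (ω : Sym2 V → Bool) : 0 ≤ pw p ω := by
  refine Finset.prod_nonneg fun e _ => ?_
  split_ifs <;> linarith

/-- Bound on the centered moment generating function of the number of sampled edges in `S`. -/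
theorem sum_pw_mul_exp_le {V : Type*} [Fintype V] [DecidableEq V] {p : ℝ} (hp0 : 0 ≤ p)
    (hp1 : p ≤ 1) (S : Finset (Sym2 V)) (s : ℝ) :
    ∑ ω : Sym2 V → Bool, pw p ω * Real.exp (s * ((S.filter fun e => ω e).card - p * S.card)) ≤
      Real.exp (p * S.card * (Real.exp s - 1 - s)) := by
  have hfac : ∀ ω : Sym2 V → Bool,
      Real.exp (s * ((S.filter fun e => ω e).card - p * S.card)) =
        Real.exp (-(s * p * S.card)) *
          ∏ e, (if e ∈ S then (if ω e then Real.exp s else 1) else 1) := by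
    intro ω
    rw [Finset.prod_ite_mem, Finset.univ_inter, ← Finset.prod_filter, Finset.prod_const,
      ← Real.exp_nat_mul, ← Real.exp_add]
    congr 1
    ring
  have hprod : ∏ e : Sym2 V, (p * (if e ∈ S then Real.exp s else 1) + (1 - p) * 1) ≤
      Real.exp (p * S.card * (Real.exp s - 1)) := by
    have hrw : ∀ e : Sym2 V, (p * (if e ∈ S then Real.exp s else 1) + (1 - p) * 1) =
        if e ∈ S then p * Real.exp s + (1 - p) else 1 := by
      intro e
      split_ifs <;> ring
    simp_rw [hrw]
    rw [Finset.prod_ite_mem, Finset.univ_inter, Finset.prod_const,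
      show p * S.card * (Real.exp s - 1) = S.card * (p * (Real.exp s - 1)) by ring,
      Real.exp_nat_mul]
    refine pow_le_pow_left₀ ?_ ?_ _
    · have := mul_nonneg hp0 (Real.exp_pos s).le
      linarith
    · have := Real.add_one_le_exp (p * (Real.exp s - 1))
      linarith
  have key := sum_pw_mul_prod p
    (fun (e : Sym2 V) b => if e ∈ S then (if b then Real.exp s else 1) else 1)
  simp only [if_true, Bool.false_eq_true, if_false, ite_self] at key
  calc _ = Real.exp (-(s * p * S.card)) *
        ∏ e : Sym2 V, (p * (if e ∈ S then Real.exp s else 1) + (1 - p) * 1) := by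
        rw [← key, Finset.mul_sum]
        refine Finset.sum_congr rfl fun ω _ => ?_
        rw [hfac ω]
        ring
    _ ≤ Real.exp (-(s * p * S.card)) * Real.exp (p * S.card * (Real.exp s - 1)) := by
        gcongr
    _ = _ := by
        rw [← Real.exp_add]
        congr 1
        ring

theorem exp_sub_one_sub_id_le {s : ℝ} (hs : |s| ≤ 1) :
    Real.exp s - 1 - s ≤ 3 / 4 * s ^ 2 := by
  have h := (abs_le.1 (Real.exp_bound hs (n := 3) (by norm_num))).2
  norm_num [Finset.sum_range_succ, Nat.factorial] at h
  have h3 : |s| ^ 3 ≤ s ^ 2 := by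
    rw [← sq_abs s]
    exact pow_le_pow_of_le_one (abs_nonneg s) hs (by norm_num)
  nlinarith [sq_nonneg s]

/-- Two-sided Chernoff bound for the number of sampled edges in `S`. -/
theorem PrE_card_filter_deviation_le {V : Type*} [Fintype V] [DecidableEq V] {p : ℝ}
    (hp0 : 0 ≤ p) (hp1 : p ≤ 1) (S : Finset (Sym2 V)) {t b : ℝ} (hb : 0 < b)
    (hSb : p * S.card ≤ b) (ht0 : 0 ≤ t) (htb : t ≤ b) :
    PrE p {ω : Sym2 V → Bool | t < |((S.filter fun e => ω e).card : ℝ) - p * S.card|} ≤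
      2 * Real.exp (-(t ^ 2 / (3 * b))) := by
  set s : ℝ := 2 * t / (3 * b) with hs
  have hs0 : 0 ≤ s := by positivity
  have hs1 : s ≤ 1 := by
    rw [hs, div_le_one (by positivity)]
    linarith
  have hbs : b * (3 / 4 * s ^ 2) - s * t = -(t ^ 2 / (3 * b)) := by
    rw [hs]
    field_simp
    ring
  have hmgf : ∀ r : ℝ, |r| = s →
      (∑ ω : Sym2 V → Bool,
        pw p ω * Real.exp (r * ((S.filter fun e => ω e).card - p * S.card))) *
          Real.exp (-(s * t)) ≤ Real.exp (-(t ^ 2 / (3 * b))) := by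
    intro r hr
    have hr2 : r ^ 2 = s ^ 2 := by rw [← hr, sq_abs]
    have hexp := exp_sub_one_sub_id_le (s := r) (hr.trans_le hs1)
    rw [hr2] at hexp
    calc _ ≤ Real.exp (p * S.card * (Real.exp r - 1 - r)) * Real.exp (-(s * t)) := by
          gcongr
          exact sum_pw_mul_exp_le hp0 hp1 S r
      _ ≤ Real.exp (b * (3 / 4 * s ^ 2)) * Real.exp (-(s * t)) := by
          refine mul_le_mul_of_nonneg_right (Real.exp_le_exp.2 ?_) (Real.exp_pos _).le
          calc p * S.card * (Real.exp r - 1 - r) ≤ p * S.card * (3 / 4 * s ^ 2) := by gcongr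
            _ ≤ b * (3 / 4 * s ^ 2) := by gcongr
      _ = _ := by rw [← Real.exp_add, ← hbs, sub_eq_add_neg]
  have hpos := hmgf s (abs_of_nonneg hs0)
  have hneg := hmgf (-s) (by rw [abs_neg, abs_of_nonneg hs0])
  refine le_trans ?_ ((add_le_add hpos hneg).trans_eq (two_mul _).symm)
  rw [← add_mul, ← Finset.sum_add_distrib, Finset.sum_mul]
  refine Finset.sum_le_sum fun ω _ => ?_
  rw [← mul_add, mul_assoc]
  refine Set.indicator_le' (s := {ω : Sym2 V → Bool |
    t < |((S.filter fun e => ω e).card : ℝ) - p * S.card|})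
    (g := fun ω => pw p ω * ((Real.exp (s * ((S.filter fun e => ω e).card - p * S.card)) +
      Real.exp (-s * ((S.filter fun e => ω e).card - p * S.card))) * Real.exp (-(s * t))))
    (fun ω hω => ?_) (fun ω _ => ?_) ω
  · refine le_mul_of_one_le_right (pw_nonneg hp0 hp1 ω) ?_
    rw [add_mul, ← Real.exp_add, ← Real.exp_add]
    rcases lt_abs.1 (Set.mem_ofPred_eq ▸ hω) with h | h
    · refine le_add_of_le_of_nonneg (Real.one_le_exp ?_) (Real.exp_pos _).le
      nlinarith
    · refine le_add_of_nonneg_of_le (Real.exp_pos _).le (Real.one_le_exp ?_)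
      nlinarith
  · have := pw_nonneg hp0 hp1 ω
    positivity

/-- Degrees in `H` and in its sampled part are counted by one set of edges. -/
theorem exists_finset_deg_eq {V : Type*} [Fintype V] [DecidableEq V] {G H : SimpleGraph V}
    (hHG : H ≤ G) (v : V) :
    ∃ S : Finset (Sym2 V), deg H v = S.card ∧
      ∀ ω : Sym2 V → Bool, deg (H ⊓ esub G ω) v = (S.filter fun e => ω e).card := by
  classical
  have hinj : Function.Injective fun u : V => s(v, u) := fun a b h => Sym2.congr_right.1 h
  refine ⟨(H.neighborFinset v).image fun u => s(v, u), ?_, fun ω => ?_⟩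
  · rw [Finset.card_image_of_injective _ hinj, deg, ← Set.ncard_coe_finset,
      SimpleGraph.coe_neighborFinset]
  · rw [Finset.filter_image, Finset.card_image_of_injective _ hinj, deg, ← Set.ncard_coe_finset]
    congr 1
    ext u
    simp only [esub, SimpleGraph.mem_neighborSet, SimpleGraph.inf_adj,
      SimpleGraph.fromEdgeSet_adj, Set.mem_ofPred_eq, Finset.coe_filter,
      SimpleGraph.mem_neighborFinset]
    exact ⟨fun h => ⟨h.1, h.2.2.1⟩, fun h => ⟨h.1, hHG h.1, h.2, h.1.ne⟩⟩

theorem IsEDCS.deg_le {V : Type*} {G H : SimpleGraph V} {β βm : ℝ}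
    (hH : IsEDCS G H β βm) (hβ : 0 ≤ β) (v : V) : (deg H v : ℝ) ≤ β := by
  rcases (H.neighborSet v).eq_empty_or_nonempty with h | ⟨u, hu⟩
  · simpa [deg, h] using hβ
  · have := hH.2.1 v u hu
    have : (0 : ℝ) ≤ deg H u := Nat.cast_nonneg _
    linarith

/-- If sampling nearly scales all degrees by `p`, then the sampled part of an EDCS is an EDCS
of the sampled graph. -/
theorem IsEDCS.inf_esub {V : Type*} {G H : SimpleGraph V} {p lam β : ℝ}
    (hp0 : 0 < p) (hp1 : p ≤ 1) (hβ : 10 ≤ lam * β)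
    (hH : IsEDCS G H ((1 - lam / 2) * β / p) ((1 - lam / 2) * β / p - 1)) {ω : Sym2 V → Bool}
    (hω : ∀ v : V, |(deg (H ⊓ esub G ω) v : ℝ) - p * (deg H v : ℝ)| ≤ lam / 5 * β) :
    IsEDCS (esub G ω) (H ⊓ esub G ω) β ((1 - lam) * β) := by
  refine ⟨inf_le_right, fun u v huv => ?_, fun u v huv hnot => ?_⟩
  · have h := hH.2.1 u v huv.1
    rw [le_div_iff₀ hp0] at h
    have hu := (abs_le.1 (hω u)).2
    have hv := (abs_le.1 (hω v)).2
    nlinarith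
  · have h := hH.2.2 u v huv.1 fun hadj => hnot ⟨hadj, huv⟩
    rw [sub_le_iff_le_add, div_le_iff₀ hp0] at h
    have hu := (abs_le.1 (hω u)).1
    have hv := (abs_le.1 (hω v)).1
    nlinarith

/-- Let `G` be a graph on `n ≥ 2` vertices, `p ∈ (0,1]`, `λ ∈ (0,1/2)`, and
`β ≥ 750·λ⁻²·log n`.  Let `H` be an `EDCS(G, β_H, β_H - 1)` with `β_H = (1-λ/2)·β/p`, and
let `G_p` be the edge sampled subgraph of `G` with probability `p` and `H_p := H ∩ G_p`.
Then with probability at least `1 - 2/n⁹`, simultaneously (1) every vertex `v` satisfies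
`|deg_{H_p}(v) - p·deg_H(v)| ≤ (λ/5)·β`, and (2) `H_p` is an `EDCS(G_p, β, (1-λ)·β)`. -/
theorem edcs_edge_sampling_claim {V : Type*} [Fintype V] [DecidableEq V]
    (G H : SimpleGraph V) (p lam β : ℝ) (hn : 2 ≤ Fintype.card V)
    (hp0 : 0 < p) (hp1 : p ≤ 1) (hlam0 : 0 < lam) (hlam1 : lam < 1 / 2)
    (hβ : 750 / lam ^ 2 * Real.log (Fintype.card V) ≤ β)
    (hH : IsEDCS G H ((1 - lam / 2) * β / p) ((1 - lam / 2) * β / p - 1)) :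
    1 - 2 / (Fintype.card V : ℝ) ^ 9 ≤
      PrE p {ω : Sym2 V → Bool |
        (∀ v : V, |(deg (H ⊓ esub G ω) v : ℝ) - p * (deg H v : ℝ)| ≤ lam / 5 * β) ∧
        IsEDCS (esub G ω) (H ⊓ esub G ω) β ((1 - lam) * β)} := by
  have hn0 : (0 : ℝ) < Fintype.card V := by
    exact_mod_cast (by omega : 0 < Fintype.card V)
  have hlog : (1 : ℝ) / 2 ≤ Real.log (Fintype.card V) := by
    have h2 : Real.log 2 ≤ Real.log (Fintype.card V) :=
      Real.log_le_log (by norm_num) (by exact_mod_cast hn)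
    linarith [Real.log_two_gt_d9]
  have hβ' : 750 * Real.log (Fintype.card V) ≤ lam ^ 2 * β := by
    rw [div_mul_eq_mul_div, div_le_iff₀ (by positivity)] at hβ
    linarith
  have hβ0 : 0 < β := by
    by_contra! h
    nlinarith [sq_nonneg lam]
  have hlamβ : 10 ≤ lam * β := by nlinarith [mul_pos hlam0 hβ0]
  have hdev : ∀ v : V,
      PrE p {ω : Sym2 V → Bool |
        lam / 5 * β < |(deg (H ⊓ esub G ω) v : ℝ) - p * (deg H v : ℝ)|} ≤
          2 / (Fintype.card V : ℝ) ^ 10 := by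
    intro v
    have hdeg := hH.deg_le (div_nonneg (mul_nonneg (by linarith) hβ0.le) hp0.le) v
    rw [le_div_iff₀ hp0] at hdeg
    obtain ⟨S, hS, hSω⟩ := exists_finset_deg_eq hH.1 v
    simp only [hS, hSω] at hdeg ⊢
    refine (PrE_card_filter_deviation_le hp0.le hp1 S hβ0 (by nlinarith) (by positivity)
      (by nlinarith)).trans ?_
    have hexp : 10 * Real.log (Fintype.card V) ≤ (lam / 5 * β) ^ 2 / (3 * β) := by
      rw [le_div_iff₀ (by positivity)]
      nlinarith
    rw [div_eq_mul_inv (2 : ℝ)]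
    refine mul_le_mul_of_nonneg_left ?_ zero_le_two
    calc Real.exp (-((lam / 5 * β) ^ 2 / (3 * β)))
        ≤ Real.exp (-(10 * Real.log (Fintype.card V))) := by gcongr
      _ = ((Fintype.card V : ℝ) ^ 10)⁻¹ := by
        rw [Real.exp_neg, show (10 : ℝ) = ((10 : ℕ) : ℝ) by norm_num, Real.exp_nat_mul,
          Real.exp_log hn0]
  have hunion : ∑ v : V, PrE p {ω : Sym2 V → Bool |
      lam / 5 * β < |(deg (H ⊓ esub G ω) v : ℝ) - p * (deg H v : ℝ)|} ≤
        2 / (Fintype.card V : ℝ) ^ 9 := by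
    refine (Finset.sum_le_sum fun v _ => hdev v).trans_eq ?_
    rw [Finset.sum_const, Finset.card_univ, nsmul_eq_mul]
    field_simp
  rw [sub_le_iff_le_add]
  refine le_trans ?_ (add_le_add_right hunion _)
  refine (sum_pw (V := V) p).symm.trans_le ?_
  unfold PrE
  rw [Finset.sum_comm, ← Finset.sum_add_distrib]
  refine Finset.sum_le_sum fun ω _ => ?_
  have hnonneg : ∀ (A : Set (Sym2 V → Bool)), 0 ≤ A.indicator (pw p) ω := fun A =>
    Set.indicator_nonneg (fun ω _ => pw_nonneg hp0.le hp1 ω) ω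
  by_cases hω : ∀ v : V, |(deg (H ⊓ esub G ω) v : ℝ) - p * (deg H v : ℝ)| ≤ lam / 5 * β
  · refine le_add_of_le_of_nonneg (le_of_eq ?_) (Finset.sum_nonneg fun v _ => hnonneg _)
    exact (Set.indicator_of_mem
      (Set.mem_ofPred.2 ⟨hω, hH.inf_esub hp0 hp1 hlamβ hω⟩) _).symm
  · push Not at hω
    obtain ⟨v, hv⟩ := hω
    refine le_add_of_nonneg_of_le (hnonneg _) ?_
    refine le_trans (le_of_eq (Set.indicator_of_mem (a := ω) (Set.mem_ofPred.2 hv) _).symm)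
      (Finset.single_le_sum (f := fun v => Set.indicator {ω : Sym2 V → Bool |
        lam / 5 * β < |(deg (H ⊓ esub G ω) v : ℝ) - p * (deg H v : ℝ)|} (pw p) ω)
        (fun v _ => hnonneg _) (Finset.mem_univ v))
end

section
/- There exists an absolute constant C > 0 such that the following holds. Let G = (V,E) be a graph on n ≥ 2 vertices, let k be an integer with 1 ≤ k ≤ n, let λ ∈ (0, 1/100), and let β ≥ 750·λ^{-2}·log n be a real. Set λ_C := C·(log n)·λ^{1/2} and assume λ_C ≤ 1/4. Let G^(1),…,G^(k) be a random k-partition of G, and for each i ∈ [k] let C^(i) be an EDCS(G^(i), β, (1−λ)·β) chosen by an arbitrary (deterministic) function of the graph G^(i). Then with probability at least 1 − 4/n⁷, the subgraph C := C^(1) ∪ … ∪ C^(k) of G is an EDCS(G, β_C, β⁻_C) with β_C := (1 + λ_C)·k·β and β⁻_C := (1 − 2λ_C)·k·β. -/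
open scoped Classical in
lemma deg_eq_card {V : Type*} [Fintype V] (H : SimpleGraph V) (v : V) :
    deg H v = (Finset.univ.filter fun w => H.Adj v w).card := by
  rw [deg, Set.ncard_eq_toFinset_card']
  congr 1
  ext w
  simp

open scoped Classical in
lemma deg_eq_sum {V : Type*} [Fintype V] (H : SimpleGraph V) (v : V) :
    (deg H v : ℝ) = ∑ w, if H.Adj v w then (1 : ℝ) else 0 := by
  rw [deg_eq_card, Finset.sum_boole]

open scoped Classical in
lemma deg_eq_sum_symm {V : Type*} [Fintype V] (H : SimpleGraph V) (v : V) :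
    (deg H v : ℝ) = ∑ w, if H.Adj w v then (1 : ℝ) else 0 := by
  simp only [deg_eq_sum, H.adj_comm v]

lemma deg_le_card {V : Type*} [Fintype V] (H : SimpleGraph V) (v : V) :
    (deg H v : ℝ) ≤ Fintype.card V := by
  classical
  rw [deg_eq_card]
  exact_mod_cast Finset.card_le_univ _

/-- In a graph in which every edge has degree sum at most `β`, all degrees are at most `β`. -/
lemma deg_le_of_edge_le {V : Type*} [Fintype V] (H : SimpleGraph V) {β : ℝ} (hβ : 0 ≤ β)
    (h : ∀ u v : V, H.Adj u v → (deg H u : ℝ) + (deg H v : ℝ) ≤ β) (v : V) :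
    (deg H v : ℝ) ≤ β := by
  by_cases hv : ∃ w, H.Adj v w
  · obtain ⟨w, hw⟩ := hv
    have := h v w hw
    have : (0 : ℝ) ≤ deg H w := Nat.cast_nonneg _
    linarith
  · push Not at hv
    rw [deg_eq_sum]
    simpa [hv] using hβ

/-! ### Existence of an EDCS -/

/-- The potential `∑ᵥ (c · deg v - (deg v)²)`, whose maximizers are EDCS's. -/
noncomputable def edcsPotential {V : Type*} [Fintype V] (c : ℝ) (H : SimpleGraph V) : ℝ :=
  ∑ v, (c * deg H v - (deg H v : ℝ) ^ 2)

lemma deg_sup_edge {V : Type*} [Fintype V] [DecidableEq V] (H : SimpleGraph V) {u v : V}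
    (h : ¬ H.Adj u v) (huv : u ≠ v) (x : V) :
    (deg (H ⊔ SimpleGraph.edge u v) x : ℝ) =
      deg H x + ((if x = u then 1 else 0) + (if x = v then 1 else 0)) := by
  classical
  have h' : ¬ H.Adj v u := fun hh => h hh.symm
  have hsum : ((if x = u then 1 else 0) + (if x = v then 1 else 0) : ℝ) =
      ∑ w, ((if x = u ∧ w = v then (1 : ℝ) else 0) + if x = v ∧ w = u then (1 : ℝ) else 0) := by
    rw [Finset.sum_add_distrib]
    simp only [ite_and]
    split_ifs <;> simp
  rw [hsum, deg_eq_sum, deg_eq_sum, ← Finset.sum_add_distrib]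
  refine Finset.sum_congr rfl fun w _ => ?_
  simp only [SimpleGraph.sup_adj, SimpleGraph.edge_adj]
  grind

lemma edcsPotential_sup_edge {V : Type*} [Fintype V] (c : ℝ) (H : SimpleGraph V) {u v : V}
    (h : ¬ H.Adj u v) (huv : u ≠ v) :
    edcsPotential c (H ⊔ SimpleGraph.edge u v) =
      edcsPotential c H + 2 * (c - 1 - (deg H u + deg H v)) := by
  classical
  have key : ∀ x, c * (deg (H ⊔ SimpleGraph.edge u v) x : ℝ)
      - (deg (H ⊔ SimpleGraph.edge u v) x : ℝ) ^ 2 =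
      (c * deg H x - (deg H x : ℝ) ^ 2) + ((if x = u then c - 1 - 2 * (deg H u : ℝ) else 0) +
        (if x = v then c - 1 - 2 * (deg H v : ℝ) else 0)) := by
    intro x
    rw [deg_sup_edge H h huv]
    by_cases hxu : x = u
    · subst hxu
      simp only [if_true, if_neg huv]
      ring
    · by_cases hxv : x = v
      · subst hxv
        simp only [if_true, if_neg hxu]
        ring
      · simp only [if_neg hxu, if_neg hxv]
        ring
  unfold edcsPotential
  rw [Finset.sum_congr rfl fun x _ => key x, Finset.sum_add_distrib, Finset.sum_add_distrib]
  simp only [Finset.sum_ite_eq', Finset.mem_univ, if_true]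
  ring

lemma exists_isEDCS {V : Type*} [Finite V] (G : SimpleGraph V) {β βm : ℝ}
    (h : βm + 2 ≤ β) : ∃ H, IsEDCS G H β βm := by
  classical
  have := Fintype.ofFinite V
  obtain ⟨H, hH, hmax⟩ := Set.exists_max_image {H : SimpleGraph V | H ≤ G}
    (edcsPotential (β - 1)) (Set.toFinite _) ⟨G, le_refl G⟩
  refine ⟨H, hH, fun u v huv => ?_, fun u v huv hn => ?_⟩
  · by_contra! hlt
    have hle : SimpleGraph.edge u v ≤ H := by
      rw [SimpleGraph.edge_le_iff]
      exact Or.inr huv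
    have hnot : ¬ (H \ SimpleGraph.edge u v).Adj u v := by
      simp [SimpleGraph.edge_adj, huv.ne]
    have heq : H \ SimpleGraph.edge u v ⊔ SimpleGraph.edge u v = H := sdiff_sup_cancel hle
    have h1 := edcsPotential_sup_edge (β - 1) (H \ SimpleGraph.edge u v) hnot huv.ne
    have h2 := deg_sup_edge (H \ SimpleGraph.edge u v) hnot huv.ne u
    have h3 := deg_sup_edge (H \ SimpleGraph.edge u v) hnot huv.ne v
    rw [heq] at h1 h2 h3
    simp only [if_true, if_neg huv.ne, if_neg huv.ne.symm] at h2 h3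
    have h4 := hmax (H \ SimpleGraph.edge u v) (show _ ≤ G from sdiff_le.trans hH)
    linarith
  · by_contra! hlt
    have h1 := edcsPotential_sup_edge (β - 1) H hn huv.ne
    have h2 := hmax (H ⊔ SimpleGraph.edge u v) (sup_le hH (by
      rw [SimpleGraph.edge_le_iff]
      exact Or.inr huv))
    linarith

/-! ### Degree distribution of two EDCS's of the same graph -/

open scoped Classical in
/-- Number of pairs `(v, w)` with `vw` an edge of `A` but not of `B`, and
`deg A v - deg B v ≥ τ`. -/
noncomputable def excess {V : Type*} [Fintype V] (A B : SimpleGraph V) (τ : ℝ) : ℝ :=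
  ∑ v with τ ≤ (deg A v : ℝ) - deg B v, (deg (A \ B) v : ℝ)

lemma deg_sdiff_sub {V : Type*} [Fintype V] (A B : SimpleGraph V) (v : V) :
    (deg (A \ B) v : ℝ) - deg (B \ A) v = (deg A v : ℝ) - deg B v := by
  classical
  simp only [deg_eq_sum, ← Finset.sum_sub_distrib]
  refine Finset.sum_congr rfl fun w _ => ?_
  simp only [SimpleGraph.sdiff_adj]
  by_cases A.Adj v w <;> by_cases B.Adj v w <;> simp [*]

lemma excess_le_sq {V : Type*} [Fintype V] (A B : SimpleGraph V) (τ : ℝ) :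
    excess A B τ ≤ (Fintype.card V : ℝ) ^ 2 := by
  classical
  calc excess A B τ ≤ ∑ v, (deg (A \ B) v : ℝ) :=
        Finset.sum_le_sum_of_subset_of_nonneg (Finset.subset_univ _) fun _ _ _ => Nat.cast_nonneg _
    _ ≤ ∑ _v : V, (Fintype.card V : ℝ) := Finset.sum_le_sum fun v _ => deg_le_card _ v
    _ = _ := by simp [sq]

lemma one_le_excess {V : Type*} [Fintype V] (A B : SimpleGraph V) {τ : ℝ} (hτ : 0 < τ) {v : V}
    (hv : τ ≤ (deg A v : ℝ) - deg B v) : 1 ≤ excess A B τ := by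
  classical
  have h1 : (deg (A \ B) v : ℝ) ≤ excess A B τ :=
    Finset.single_le_sum (f := fun v => (deg (A \ B) v : ℝ)) (fun _ _ => Nat.cast_nonneg _)
      (by simpa using hv)
  have h2 := deg_sdiff_sub A B v
  have h3 : (0 : ℝ) ≤ deg (B \ A) v := Nat.cast_nonneg _
  have h4 : (0 : ℝ) < deg (A \ B) v := by linarith
  have h5 : (1 : ℝ) ≤ deg (A \ B) v := by exact_mod_cast h4
  linarith

lemma deg_mono {V : Type*} [Fintype V] {A B : SimpleGraph V} (h : A ≤ B) (v : V) :
    (deg A v : ℝ) ≤ deg B v := by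
  exact_mod_cast Set.ncard_le_ncard (fun w hw => h hw) (Set.toFinite _)

lemma excess_le_excess {V : Type*} [Fintype V] {G A B : SimpleGraph V} {β ε τ r : ℝ}
    (hβ : 0 < β) (hA : IsEDCS G A β (β - ε)) (hB : IsEDCS G B β (β - ε))
    (hr : 0 ≤ r) (hτ : r * β ≤ τ - ε) :
    excess A B τ ≤ (1 - r) * excess B A (τ - ε) := by
  classical
  have step : excess A B τ ≤ ∑ w with τ - ε ≤ (deg B w : ℝ) - deg A w, (deg (A \ B) w : ℝ) := by
    unfold excess
    rw [Finset.sum_congr rfl fun v _ => deg_eq_sum_symm (A \ B) v, Finset.sum_comm,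
      Finset.sum_filter]
    refine Finset.sum_le_sum fun w _ => ?_
    split_ifs with hw
    · rw [deg_eq_sum]
      refine Finset.sum_le_sum_of_subset_of_nonneg (Finset.subset_univ _) fun v _ _ => ?_
      split_ifs <;> norm_num
    · refine (Finset.sum_eq_zero fun v hv => ?_).le
      rw [if_neg]
      intro hadj
      rw [SimpleGraph.sdiff_adj] at hadj
      have hv' := (Finset.mem_filter.mp hv).2
      have h1 := hA.2.1 w v hadj.1
      have h2 := hB.2.2 w v (hA.1 hadj.1) hadj.2
      exact hw (by linarith)
  have hsum : ∑ w with τ - ε ≤ (deg B w : ℝ) - deg A w, (deg (A \ B) w : ℝ) ≤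
      ∑ w with τ - ε ≤ (deg B w : ℝ) - deg A w, (1 - r) * (deg (B \ A) w : ℝ) := by
    refine Finset.sum_le_sum fun w hw => ?_
    have hw' := (Finset.mem_filter.mp hw).2
    have h1 := deg_sdiff_sub B A w
    have h2 := deg_le_of_edge_le B hβ.le hB.2.1 w
    have h3 := deg_mono (sdiff_le : B \ A ≤ B) w
    have h4 : (0 : ℝ) ≤ deg (B \ A) w := Nat.cast_nonneg _
    have h5 : (0 : ℝ) ≤ deg (A \ B) w := Nat.cast_nonneg _
    have := mul_le_mul_of_nonneg_left (h3.trans h2) hr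
    linarith
  refine step.trans (hsum.trans_eq ?_)
  rw [excess, Finset.mul_sum]

lemma excess_le_iterate {V : Type*} [Fintype V] {G : SimpleGraph V} {β ε r : ℝ}
    (hβ : 0 < β) (hε : 0 ≤ ε) (hr : 0 ≤ r) (m : ℕ) :
    ∀ {A B : SimpleGraph V}, IsEDCS G A β (β - ε) → IsEDCS G B β (β - ε) →
      excess A B (m * ε + r * β) ≤ Real.exp (-(m * r)) * (Fintype.card V : ℝ) ^ 2 := by
  induction m with
  | zero =>
    intro A B _ _
    simpa using excess_le_sq A B _
  | succ m ih =>
    intro A B hA hB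
    have hτ : ((m + 1 : ℕ) : ℝ) * ε + r * β - ε = m * ε + r * β := by push_cast; ring
    have hm : (0 : ℝ) ≤ m * ε := by positivity
    have h1 := excess_le_excess (τ := ((m + 1 : ℕ) : ℝ) * ε + r * β) hβ hA hB hr (by linarith)
    rw [hτ] at h1
    have h2 := ih hB hA
    have h3 : 0 ≤ excess B A (m * ε + r * β) := Finset.sum_nonneg fun _ _ => Nat.cast_nonneg _
    have h4 : 1 - r ≤ Real.exp (-r) := by linarith [Real.add_one_le_exp (-r)]
    calc excess A B (((m + 1 : ℕ) : ℝ) * ε + r * β)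
        ≤ (1 - r) * excess B A (m * ε + r * β) := h1
      _ ≤ Real.exp (-r) * excess B A (m * ε + r * β) := by gcongr
      _ ≤ Real.exp (-r) * (Real.exp (-(m * r)) * (Fintype.card V : ℝ) ^ 2) := by gcongr
      _ = _ := by
        rw [← mul_assoc, ← Real.exp_add]
        push_cast
        ring_nf

/-- Any two EDCS's of the same graph have nearly the same degrees. -/
lemma deg_sub_deg_le {V : Type*} [Fintype V] {G A B : SimpleGraph V} {β ε r : ℝ}
    (hβ : 0 < β) (hε : 0 ≤ ε) (hr : 0 < r) (hA : IsEDCS G A β (β - ε))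
    (hB : IsEDCS G B β (β - ε)) (v : V) :
    (deg A v : ℝ) - deg B v ≤ (2 * Real.log (Fintype.card V) / r + 1) * ε + r * β := by
  by_contra! hlt
  have hn : (0 : ℝ) < Fintype.card V := by
    have : Nonempty V := ⟨v⟩
    exact_mod_cast Fintype.card_pos
  have hlog : 0 ≤ Real.log (Fintype.card V) := Real.log_natCast_nonneg _
  set m := ⌊2 * Real.log (Fintype.card V) / r⌋₊ + 1 with hm
  have hm1 : (m : ℝ) ≤ 2 * Real.log (Fintype.card V) / r + 1 := by
    rw [hm]
    push_cast
    gcongr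
    exact Nat.floor_le (by positivity)
  have hm2 : 2 * Real.log (Fintype.card V) < m * r := by
    rw [← div_lt_iff₀ hr, hm]
    exact_mod_cast Nat.lt_floor_add_one _
  have h1 := one_le_excess A B (τ := m * ε + r * β) (by positivity) (v := v) (by
    have := mul_le_mul_of_nonneg_right hm1 hε
    linarith)
  have h2 := excess_le_iterate hβ hε hr.le m hA hB
  have h3 : Real.exp (-(m * r)) * (Fintype.card V : ℝ) ^ 2 < 1 := by
    have : (Fintype.card V : ℝ) ^ 2 = Real.exp (2 * Real.log (Fintype.card V)) := by
      rw [two_mul, Real.exp_add, Real.exp_log hn, sq]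
    rw [this, ← Real.exp_add, Real.exp_lt_one_iff]
    linarith
  linarith

/-! ### Concentration of the degrees in a random part -/

open scoped Classical in
/-- Exponential moment of the number of elements of `F` coloured `i` by a random colouring. -/
lemma sum_exp_card_le {α : Type*} [Fintype α] [DecidableEq α] {k : ℕ} (i : Fin k)
    (F : Finset α) {t : ℝ} (ht : |t| ≤ 1) :
    ∑ ω : α → Fin k, Real.exp (t * (F.filter fun e => ω e = i).card) ≤
      Fintype.card (α → Fin k) * Real.exp ((F.card : ℝ) / k * (t + t ^ 2)) := by
  have hk : (0 : ℝ) < k := by exact_mod_cast i.pos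
  have h1 : ∀ ω : α → Fin k, Real.exp (t * (F.filter fun e => ω e = i).card) =
      ∏ e, (if e ∈ F ∧ ω e = i then Real.exp t else 1) := by
    intro ω
    rw [Finset.prod_ite, Finset.prod_const_one, mul_one, Finset.prod_const, ← Real.exp_nat_mul,
      mul_comm]
    congr 4
    ext e
    simp
  have h2 : ∀ e : α, ∑ j : Fin k, (if e ∈ F ∧ j = i then Real.exp t else 1) ≤
      k * (if e ∈ F then Real.exp ((t + t ^ 2) / k) else 1) := by
    intro e
    by_cases he : e ∈ F
    · have hexp : Real.exp t ≤ 1 + t + t ^ 2 := by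
        have := Real.abs_exp_sub_one_sub_id_le ht
        linarith [(abs_le.mp this).2]
      have hsum : ∑ j : Fin k, (if j = i then Real.exp t else (1 : ℝ)) = k + (Real.exp t - 1) := by
        have : ∀ j : Fin k, (if j = i then Real.exp t else (1 : ℝ)) =
            1 + if j = i then Real.exp t - 1 else 0 := fun j => by split_ifs <;> ring
        rw [Finset.sum_congr rfl fun j _ => this j, Finset.sum_add_distrib]
        simp
      simp only [he, true_and, if_true]
      rw [hsum]
      have h3 := mul_le_mul_of_nonneg_left (Real.add_one_le_exp ((t + t ^ 2) / k)) hk.le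
      have h4 : (k : ℝ) * ((t + t ^ 2) / k + 1) = t + t ^ 2 + k := by field_simp
      linarith
    · simp [he]
  calc ∑ ω : α → Fin k, Real.exp (t * (F.filter fun e => ω e = i).card)
      = ∏ e : α, ∑ j : Fin k, (if e ∈ F ∧ j = i then Real.exp t else 1) := by
        rw [Finset.sum_congr rfl fun ω _ => h1 ω, Fintype.prod_sum]
    _ ≤ ∏ e : α, ((k : ℝ) * (if e ∈ F then Real.exp ((t + t ^ 2) / k) else 1)) :=
        Finset.prod_le_prod (fun e _ => Finset.sum_nonneg fun j _ => by split_ifs <;> positivity)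
          fun e _ => h2 e
    _ = _ := by
        rw [Finset.prod_mul_distrib, Finset.prod_ite_mem, Finset.univ_inter, Finset.prod_const,
          Finset.prod_const, ← Real.exp_nat_mul]
        simp only [Fintype.card_fun, Fintype.card_fin, Nat.cast_pow, Finset.card_univ]
        congr 2
        ring

open scoped Classical in
/-- Chernoff bound for the number of elements of `F` coloured `i`. -/
lemma card_deviation_le {α : Type*} [Fintype α] [DecidableEq α] {k : ℕ} (i : Fin k)
    (F : Finset α) {t : ℝ} (ht : |t| ≤ 1) (s : ℝ) :
    ((Finset.univ.filter fun ω : α → Fin k =>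
        s ≤ t * ((F.filter fun e => ω e = i).card - (F.card : ℝ) / k)).card : ℝ) ≤
      Fintype.card (α → Fin k) * Real.exp ((F.card : ℝ) / k * t ^ 2 - s) := by
  set μ : ℝ := (F.card : ℝ) / k with hμ
  set S := Finset.univ.filter fun ω : α → Fin k =>
        s ≤ t * ((F.filter fun e => ω e = i).card - μ) with hS
  have h1 : (S.card : ℝ) * Real.exp (s + t * μ) ≤
      ∑ ω : α → Fin k, Real.exp (t * (F.filter fun e => ω e = i).card) := by
    rw [← nsmul_eq_mul]
    refine (Finset.card_nsmul_le_sum S _ _ fun ω hω => ?_).trans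
      (Finset.sum_le_sum_of_subset_of_nonneg (Finset.subset_univ _) fun _ _ _ => by positivity)
    have := (Finset.mem_filter.mp hω).2
    rw [Real.exp_le_exp]
    linarith
  have h2 := h1.trans (sum_exp_card_le i F ht)
  rw [← le_div_iff₀ (Real.exp_pos _), mul_div_assoc, ← Real.exp_sub] at h2
  have h3 : (F.card : ℝ) / k * (t + t ^ 2) - (s + t * μ) = μ * t ^ 2 - s := by
    rw [hμ]
    ring
  rwa [h3] at h2

open scoped Classical in
/-- The edges of `H` at the vertex `v`. -/
noncomputable def edgesAt {V : Type*} [Fintype V] (H : SimpleGraph V) (v : V) : Finset (Sym2 V) :=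
  (Finset.univ.filter fun w => H.Adj v w).image fun w => s(v, w)

lemma card_edgesAt {V : Type*} [Fintype V] (H : SimpleGraph V) (v : V) :
    ((edgesAt H v).card : ℝ) = deg H v := by
  classical
  rw [edgesAt, Finset.card_image_of_injective _ fun a b hab => Sym2.congr_right.mp hab,
    deg_eq_card]

open scoped Classical in
lemma card_edgesAt_filter {V : Type*} [Fintype V] {G H : SimpleGraph V} (hH : H ≤ G) {k : ℕ}
    (ω : Sym2 V → Fin k) (i : Fin k) (v : V) :
    (((edgesAt H v).filter fun e => ω e = i).card : ℝ) = deg (H ⊓ part G ω i) v := by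
  rw [edgesAt, Finset.filter_image,
    Finset.card_image_of_injective _ fun a b hab => Sym2.congr_right.mp hab,
    deg_eq_card, Finset.filter_filter]
  congr 2
  ext w
  simp only [part, Finset.mem_filter, Finset.mem_univ, true_and, SimpleGraph.inf_adj,
    SimpleGraph.fromEdgeSet_adj, Set.mem_ofPred_eq]
  exact ⟨fun h => ⟨h.1, hH h.1, h.2, h.1.ne⟩, fun h => ⟨h.1, h.2.2.1⟩⟩

open scoped Classical in
/-- With few exceptions, the degrees of `H` within each part are close to their average. -/
lemma card_exists_deviation_le {V : Type*} [Fintype V] [DecidableEq V] {G H : SimpleGraph V}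
    (hH : H ≤ G) {k : ℕ} {δ β : ℝ} (hδ : 0 < δ) (hδ1 : δ ≤ 1)
    (hdeg : ∀ v, (deg H v : ℝ) / k ≤ β) :
    ((Finset.univ.filter fun ω : Sym2 V → Fin k =>
        ∃ (i : Fin k) (v : V), δ * β < |(deg (H ⊓ part G ω i) v : ℝ) - deg H v / k|).card : ℝ) ≤
      Fintype.card (Sym2 V → Fin k) *
        (2 * k * Fintype.card V * Real.exp (-(δ ^ 2 * β / 4))) := by
  set N : ℝ := ((Fintype.card (Sym2 V → Fin k) : ℕ) : ℝ) with hN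
  set Bad : ℝ → Fin k × V → Finset (Sym2 V → Fin k) := fun t p =>
    Finset.univ.filter fun ω => δ ^ 2 * β / 2 ≤
      t * (((edgesAt H p.2).filter fun e => ω e = p.1).card - ((edgesAt H p.2).card : ℝ) / k)
    with hBad
  have hbad : ∀ t : ℝ, |t| = δ / 2 → ∀ p, ((Bad t p).card : ℝ) ≤
      N * Real.exp (-(δ ^ 2 * β / 4)) := by
    intro t ht p
    refine (card_deviation_le p.1 (edgesAt H p.2) (by rw [ht]; linarith) _).trans ?_
    have hsq : t ^ 2 = δ ^ 2 / 4 := by rw [← sq_abs, ht]; ring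
    have := mul_le_mul_of_nonneg_right (hdeg p.2) (by positivity : 0 ≤ δ ^ 2 / 4)
    rw [card_edgesAt, hsq]
    gcongr
    linarith
  have hsub : (Finset.univ.filter fun ω : Sym2 V → Fin k =>
      ∃ (i : Fin k) (v : V), δ * β < |(deg (H ⊓ part G ω i) v : ℝ) - deg H v / k|) ⊆
      Finset.univ.biUnion fun p => Bad (δ / 2) p ∪ Bad (-(δ / 2)) p := by
    intro ω hω
    obtain ⟨i, v, h⟩ := (Finset.mem_filter.mp hω).2
    simp only [hBad, Finset.mem_biUnion, Finset.mem_union, Finset.mem_filter, Finset.mem_univ,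
      true_and]
    refine ⟨(i, v), ?_⟩
    rw [card_edgesAt_filter hH, card_edgesAt]
    rcases lt_abs.mp h with h | h
    · exact Or.inl (by nlinarith)
    · exact Or.inr (by nlinarith)
  have hcard : ((Finset.univ.biUnion fun p => Bad (δ / 2) p ∪ Bad (-(δ / 2)) p).card : ℝ) ≤
      ∑ p : Fin k × V, (((Bad (δ / 2) p).card : ℝ) + (Bad (-(δ / 2)) p).card) := by
    exact_mod_cast Finset.card_biUnion_le.trans
      (Finset.sum_le_sum fun p _ => Finset.card_union_le _ _)
  have h2 : |δ / 2| = δ / 2 := abs_of_pos (by linarith)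
  calc _ ≤ ((Finset.univ.biUnion fun p => Bad (δ / 2) p ∪ Bad (-(δ / 2)) p).card : ℝ) := by
        exact_mod_cast Finset.card_le_card hsub
    _ ≤ _ := hcard
    _ ≤ ∑ _p : Fin k × V, (N * Real.exp (-(δ ^ 2 * β / 4)) + N * Real.exp (-(δ ^ 2 * β / 4))) :=
        Finset.sum_le_sum fun p _ =>
          add_le_add (hbad _ h2 p) (hbad _ (by rw [abs_neg, h2]) p)
    _ = _ := by
        rw [Finset.sum_const, Finset.card_univ, Fintype.card_prod, Fintype.card_fin, nsmul_eq_mul]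
        push_cast
        ring

/-! ### The union of the EDCS's of the parts -/

lemma deg_iSup_part {V : Type*} [Fintype V] {G : SimpleGraph V} {k : ℕ} (ω : Sym2 V → Fin k)
    (A : Fin k → SimpleGraph V) (hA : ∀ i, A i ≤ part G ω i) (v : V) :
    (deg (⨆ i, A i) v : ℝ) = ∑ i, (deg (A i) v : ℝ) := by
  classical
  simp only [deg_eq_sum]
  rw [Finset.sum_comm]
  refine Finset.sum_congr rfl fun w _ => ?_
  have hi : ∀ i, (A i).Adj v w → i = ω s(v, w) := fun i h => by
    have := hA i h
    simp only [part, SimpleGraph.inf_adj, SimpleGraph.fromEdgeSet_adj, Set.mem_ofPred_eq] at this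
    exact this.2.1.symm
  rw [Finset.sum_eq_single (ω s(v, w)) (fun i _ hne => if_neg fun h => hne (hi i h))
    (fun h => absurd (Finset.mem_univ _) h)]
  have : (⨆ i, A i).Adj v w ↔ (A (ω s(v, w))).Adj v w := by
    rw [SimpleGraph.iSup_adj]
    exact ⟨fun ⟨i, h⟩ => hi i h ▸ h, fun h => ⟨_, h⟩⟩
  simp only [this]

lemma IsEDCS.mono {V : Type*} {G H : SimpleGraph V} {β βm β' βm' : ℝ} (h : IsEDCS G H β βm)
    (hβ : β ≤ β') (hβm : βm' ≤ βm) : IsEDCS G H β' βm' :=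
  ⟨h.1, fun u v huv => (h.2.1 u v huv).trans hβ, fun u v huv hn => hβm.trans (h.2.2 u v huv hn)⟩

/-- If the vertex degrees of EDCS's of the parts are all close to common values `d v`,
the union of these is an EDCS. -/
lemma isEDCS_iSup_of_close {V : Type*} [Fintype V] {G : SimpleGraph V} {k : ℕ}
    (ω : Sym2 V → Fin k) (A : Fin k → SimpleGraph V) {β βm Δ : ℝ}
    (hA : ∀ i, IsEDCS (part G ω i) (A i) β βm) (d : V → ℝ)
    (hd : ∀ i v, |(deg (A i) v : ℝ) - d v| ≤ Δ) :
    IsEDCS G (⨆ i, A i) (k * (β + 4 * Δ)) (k * (βm - 4 * Δ)) := by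
  have hsum : ∀ v, k * (d v - Δ) ≤ (deg (⨆ i, A i) v : ℝ) ∧
      (deg (⨆ i, A i) v : ℝ) ≤ k * (d v + Δ) := by
    intro v
    rw [deg_iSup_part ω A (fun i => (hA i).1)]
    have hc : ∀ x : ℝ, (k : ℝ) * x = ∑ _i : Fin k, x := fun x => by simp
    rw [hc, hc]
    exact ⟨Finset.sum_le_sum fun i _ => by linarith [(abs_le.mp (hd i v)).1],
      Finset.sum_le_sum fun i _ => by linarith [(abs_le.mp (hd i v)).2]⟩
  have hk : (0 : ℝ) ≤ k := Nat.cast_nonneg k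
  refine ⟨iSup_le fun i => (hA i).1.trans inf_le_left, fun u v huv => ?_, fun u v huv hn => ?_⟩
  · obtain ⟨i, hi⟩ := SimpleGraph.iSup_adj.mp huv
    have h1 := (hA i).2.1 u v hi
    have h2 : d u + Δ + (d v + Δ) ≤ β + 4 * Δ := by
      linarith [(abs_le.mp (hd i u)).1, (abs_le.mp (hd i v)).1]
    have h3 := mul_le_mul_of_nonneg_left h2 hk
    linarith [(hsum u).2, (hsum v).2]
  · have hp : (part G ω (ω s(u, v))).Adj u v := by
      simp [part, huv, huv.ne]
    have hni : ¬ (A (ω s(u, v))).Adj u v := fun h => hn (SimpleGraph.iSup_adj.mpr ⟨_, h⟩)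
    have h1 := (hA _).2.2 u v hp hni
    have h2 : βm - 4 * Δ ≤ d u - Δ + (d v - Δ) := by
      linarith [(abs_le.mp (hd (ω s(u, v)) u)).2, (abs_le.mp (hd (ω s(u, v)) v)).2]
    have h3 := mul_le_mul_of_nonneg_left h2 hk
    linarith [(hsum u).1, (hsum v).1]

/-- The restriction to a part of an EDCS of `G` whose degrees concentrate is an EDCS. -/
lemma isEDCS_inf_part {V : Type*} {G H : SimpleGraph V} {k : ℕ}
    (ω : Sym2 V → Fin k) (i : Fin k) {β βm Δ : ℝ} (hH : IsEDCS G H (k * β) (k * βm))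
    (hd : ∀ v, |(deg (H ⊓ part G ω i) v : ℝ) - deg H v / k| ≤ Δ) :
    IsEDCS (part G ω i) (H ⊓ part G ω i) (β + 2 * Δ) (βm - 2 * Δ) := by
  have hk : (0 : ℝ) < k := by exact_mod_cast i.pos
  refine ⟨inf_le_right, fun u v huv => ?_, fun u v huv hn => ?_⟩
  · have h1 : (deg H u : ℝ) / k + deg H v / k ≤ β := by
      rw [← add_div, div_le_iff₀' hk]
      exact hH.2.1 u v huv.1
    linarith [(abs_le.mp (hd u)).2, (abs_le.mp (hd v)).2]
  · have h1 : βm ≤ (deg H u : ℝ) / k + deg H v / k := by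
      rw [← add_div, le_div_iff₀' hk]
      exact hH.2.2 u v huv.1 fun h => hn ⟨h, huv⟩
    linarith [(abs_le.mp (hd u)).1, (abs_le.mp (hd v)).1]

/-- The union of EDCS's of the parts is an EDCS whenever some EDCS of `G` splits evenly. -/
lemma isEDCS_iSup_of_deviation_le {V : Type*} [Fintype V] {G H : SimpleGraph V} {k : ℕ}
    {lam β : ℝ} (hn : 2 ≤ Fintype.card V) (hlam : 0 < lam) (hlam1 : lam < 1 / 100) (hβ : 0 < β)
    (hH : IsEDCS G H (k * β) (k * ((1 - lam) * β)))
    (ω : Sym2 V → Fin k) (A : Fin k → SimpleGraph V)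
    (hA : ∀ i, IsEDCS (part G ω i) (A i) β ((1 - lam) * β))
    (hd : ∀ i v, |(deg (H ⊓ part G ω i) v : ℝ) - deg H v / k| ≤ lam * β) :
    IsEDCS G (⨆ i, A i)
      ((1 + 100 * Real.log (Fintype.card V) * Real.sqrt lam) * k * β)
      ((1 - 2 * (100 * Real.log (Fintype.card V) * Real.sqrt lam)) * k * β) := by
  set s := Real.sqrt lam with hs
  set L := Real.log (Fintype.card V) with hL
  have hs0 : 0 < s := Real.sqrt_pos.mpr hlam
  have hss : lam = s * s := (Real.mul_self_sqrt hlam.le).symm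
  have hs1 : s ≤ 1 / 10 := by nlinarith
  have hL1 : 1 / 2 ≤ L := by
    have h2 : Real.log 2 ≤ L := Real.log_le_log (by norm_num) (by exact_mod_cast hn)
    linarith [Real.log_two_gt_d9]
  have hlams : lam ≤ s / 10 := by nlinarith
  have hsL : s ≤ 2 * (L * s) := by nlinarith
  have hlamβ : 0 < lam * β := by positivity
  have hclose : ∀ i v, |(deg (A i) v : ℝ) - deg H v / k| ≤ 15 * (L * s) * β := by
    intro i v
    have hβ' : 0 < β + 2 * (lam * β) := by positivity
    have hε : 0 ≤ 5 * (lam * β) := by positivity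
    have hB : IsEDCS (part G ω i) (H ⊓ part G ω i) (β + 2 * (lam * β))
        (β + 2 * (lam * β) - 5 * (lam * β)) :=
      (isEDCS_inf_part ω i hH (hd i)).mono le_rfl (by linarith)
    have hA' : IsEDCS (part G ω i) (A i) (β + 2 * (lam * β))
        (β + 2 * (lam * β) - 5 * (lam * β)) :=
      (hA i).mono (by linarith) (by linarith)
    have h1 := deg_sub_deg_le hβ' hε hs0 hA' hB v
    have h2 := deg_sub_deg_le hβ' hε hs0 hB hA' v
    have h3 := abs_le.mp (hd i v)
    have h4 : (2 * L / s + 1) * (5 * (lam * β)) + s * (β + 2 * (lam * β)) + lam * β ≤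
        15 * (L * s) * β := by
      have h5 : 2 * L / s * (5 * (lam * β)) = 10 * (L * s) * β := by
        rw [hss]
        field_simp
        ring
      have h6 : s * (β + 2 * (lam * β)) ≤ (102 / 100 * s) * β := by
        have : s * lam ≤ s * (1 / 100) := by gcongr
        have := mul_le_mul_of_nonneg_right this hβ.le
        linarith
      have h7 := mul_le_mul_of_nonneg_right hlams hβ.le
      have h8 := mul_le_mul_of_nonneg_right hsL hβ.le
      linarith
    rw [← hL] at h1 h2
    rw [abs_le]
    constructor <;> linarith
  have hk : (0 : ℝ) ≤ k := Nat.cast_nonneg k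
  have hLs : 0 ≤ L * s * β := by positivity
  refine (isEDCS_iSup_of_close ω A hA _ hclose).mono ?_ ?_
  · have : β + 4 * (15 * (L * s) * β) ≤ (1 + 100 * L * s) * β := by linarith
    have := mul_le_mul_of_nonneg_left this hk
    linarith
  · have h7 := mul_le_mul_of_nonneg_right hlams hβ.le
    have h8 := mul_le_mul_of_nonneg_right hsL hβ.le
    have : (1 - 2 * (100 * L * s)) * β ≤ (1 - lam) * β - 4 * (15 * (L * s) * β) := by linarith
    have := mul_le_mul_of_nonneg_left this hk
    linarith

/-- There is an absolute constant `C > 0` such that the following holds.  Let `G` be a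
graph on `n ≥ 2` vertices, `1 ≤ k ≤ n`, `λ ∈ (0,1/100)` and `β ≥ 750·λ⁻²·log n`; set
`λ_C := C·(log n)·√λ` and assume `λ_C ≤ 1/4`.  Take a random `k`-partition
`G^(1),…,G^(k)` of `G` and for each `i` an `EDCS(G^(i), β, (1-λ)β)` denoted
`C^(i) := f i G^(i)`, chosen by an arbitrary deterministic function of `G^(i)`.  Then with
probability at least `1 - 4/n⁷`, the union `C^(1) ∪ … ∪ C^(k)` is an
`EDCS(G, (1+λ_C)·k·β, (1-2λ_C)·k·β)`. -/
theorem edcs_union_of_partition :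
    ∃ C : ℝ, 0 < C ∧
      ∀ (V : Type) [Fintype V] [DecidableEq V] (G : SimpleGraph V) (k : ℕ) (lam β : ℝ),
        2 ≤ Fintype.card V → 1 ≤ k → k ≤ Fintype.card V →
        0 < lam → lam < 1 / 100 →
        750 / lam ^ 2 * Real.log (Fintype.card V) ≤ β →
        C * Real.log (Fintype.card V) * Real.sqrt lam ≤ 1 / 4 →
        ∀ f : Fin k → SimpleGraph V → SimpleGraph V,
          (∀ (ω : Sym2 V → Fin k) (i : Fin k),
            IsEDCS (part G ω i) (f i (part G ω i)) β ((1 - lam) * β)) →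
          1 - 4 / (Fintype.card V : ℝ) ^ 7 ≤
            PrU {ω : Sym2 V → Fin k |
              IsEDCS G (⨆ i : Fin k, f i (part G ω i))
                ((1 + C * Real.log (Fintype.card V) * Real.sqrt lam) * k * β)
                ((1 - 2 * (C * Real.log (Fintype.card V) * Real.sqrt lam)) * k * β)} := by
  classical
  refine ⟨100, by norm_num, ?_⟩
  intro V _ _ G k lam β hn hk hkn hlam hlam1 hβ _ f hf
  have hn' : (2 : ℝ) ≤ Fintype.card V := by exact_mod_cast hn
  have hk' : (1 : ℝ) ≤ k := by exact_mod_cast hk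
  have hkn' : (k : ℝ) ≤ Fintype.card V := by exact_mod_cast hkn
  set n : ℝ := ((Fintype.card V : ℕ) : ℝ) with hndef
  have hn0 : 0 < n := by linarith
  have hL : 1 / 2 ≤ Real.log n := by
    have h2 : Real.log 2 ≤ Real.log n := Real.log_le_log (by norm_num) hn'
    linarith [Real.log_two_gt_d9]
  have hlamβ : 750 * Real.log n ≤ lam ^ 2 * β := by
    have := mul_le_mul_of_nonneg_left hβ (sq_nonneg lam)
    calc 750 * Real.log n = lam ^ 2 * (750 / lam ^ 2 * Real.log n) := by field_simp
      _ ≤ _ := this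
  have hβ0 : 0 < β := by
    by_contra! h
    nlinarith [sq_nonneg lam]
  have hlamβ1 : 2 ≤ lam * β := by nlinarith [mul_pos hlam hβ0]
  obtain ⟨H, hH⟩ := exists_isEDCS G (β := k * β) (βm := k * ((1 - lam) * β)) (by
    nlinarith [mul_le_mul hk' hlamβ1 (by norm_num) (by linarith)])
  have hdeg : ∀ v, (deg H v : ℝ) / k ≤ β := fun v => by
    rw [div_le_iff₀' (by linarith)]
    exact deg_le_of_edge_le H (by positivity) hH.2.1 v
  have hcard := card_exists_deviation_le hH.1 (k := k) hlam (by linarith) hdeg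
  set N : ℝ := ((Fintype.card (Sym2 V → Fin k) : ℕ) : ℝ) with hN
  set Bad := Finset.univ.filter fun ω : Sym2 V → Fin k =>
    ∃ (i : Fin k) (v : V), lam * β < |(deg (H ⊓ part G ω i) v : ℝ) - deg H v / k| with hBad
  have hNpos : 0 < N := by
    have : Nonempty (Fin k) := ⟨⟨0, hk⟩⟩
    exact Nat.cast_pos.mpr Fintype.card_pos
  have hexp : 2 * k * n * Real.exp (-(lam ^ 2 * β / 4)) ≤ 4 / n ^ 7 := by
    have h1 : Real.exp (-(lam ^ 2 * β / 4)) ≤ (n ^ 9)⁻¹ := by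
      rw [← Real.exp_log (by positivity : 0 < (n ^ 9)⁻¹), Real.exp_le_exp, Real.log_inv,
        Real.log_pow]
      push_cast
      linarith
    calc 2 * k * n * Real.exp (-(lam ^ 2 * β / 4)) ≤ 2 * n * n * (n ^ 9)⁻¹ := by gcongr
      _ = 2 / n ^ 7 := by field_simp
      _ ≤ 4 / n ^ 7 := by gcongr; norm_num
  have hsub : (↑(Badᶜ) : Set (Sym2 V → Fin k)) ⊆ {ω : Sym2 V → Fin k |
      IsEDCS G (⨆ i : Fin k, f i (part G ω i)) ((1 + 100 * Real.log n * Real.sqrt lam) * k * β)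
        ((1 - 2 * (100 * Real.log n * Real.sqrt lam)) * k * β)} := by
    intro ω hω
    have hgood : ∀ i v, |(deg (H ⊓ part G ω i) v : ℝ) - deg H v / k| ≤ lam * β := by
      simpa [hBad] using hω
    exact isEDCS_iSup_of_deviation_le hn hlam hlam1 hβ0 hH ω _ (fun i => hf ω i) hgood
  have hncard := Set.ncard_le_ncard hsub (Set.toFinite _)
  rw [Set.ncard_coe_finset] at hncard
  have hcompl : (Bad.card : ℝ) + (Badᶜ.card : ℝ) = N := by
    rw [hN]
    exact_mod_cast Finset.card_add_card_compl Bad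
  rw [PrU, le_div_iff₀ hNpos]
  have h1 : (Badᶜ.card : ℝ) ≤ _ := Nat.cast_le.mpr hncard
  have h2 := mul_le_mul_of_nonneg_left hexp hNpos.le
  linarith
end
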